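/- (Parter–Wiener Theorem) Let T be a tree, M a real symmetric matrix with underlying graph T, and λ a real number with multiplicity m_M(λ) ≥ 2. Then there exists a vertex v of T of degree at least 3 such that the multiplicity of λ in the principal submatrix M[T−v] (obtained by deleting the row and column of v) equals m_M(λ)+1, and λ is an eigenvalue of M[T_i] for at least three distinct connected components T_i of T−v. -/

import Mathlib

open Matrix Polynomial

def MatchesGraph {α : Type*} (A : Matrix α α ℝ) (G : SimpleGraph α) : Prop :=
  ∀ i j, i ≠ j → (A i j ≠ 0 ↔ G.Adj i j)

noncomputable def multEig {α : Type*} [Fintype α] [DecidableEq α]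
    (A : Matrix α α ℝ) (lam : ℝ) : ℕ :=
  A.charpoly.rootMultiplicity lam

noncomputable def KK {α : Type*} [Fintype α] (A : Matrix α α ℝ) (lam : ℝ) : Submodule ℝ (α → ℝ) :=
  LinearMap.ker (A.mulVecLin - lam • LinearMap.id)

lemma mem_KK {α : Type*} [Fintype α] {A : Matrix α α ℝ} {lam : ℝ} {x : α → ℝ} :
    x ∈ KK A lam ↔ ∀ i, ∑ j, A i j * x j = lam * x i := by
  simp only [KK, LinearMap.mem_ker, LinearMap.sub_apply, sub_eq_zero, Matrix.mulVecLin_apply, funext_iff]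
  rfl

lemma multEig_eq {α : Type*} [Fintype α] [DecidableEq α]
    (A : Matrix α α ℝ) (hA : A.IsSymm) (lam : ℝ) : multEig A lam = Module.finrank ℝ (KK A lam) := by
  have hs : (A.toEuclideanLin).IsSymmetric := by
    rw [Matrix.isSymmetric_toEuclideanLin_iff, Matrix.IsHermitian, Matrix.conjTranspose_eq_transpose_of_trivial]
    exact hA
  have h1 := LinearMap.finrank_maxGenEigenspace_eq (A.toEuclideanLin) lam
  rw [hs.isFinitelySemisimple.maxGenEigenspace_eq_eigenspace] at h1
  have h2 : (A.toEuclideanLin).charpoly = A.charpoly := by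
    simp [Matrix.toEuclideanLin, Matrix.toLpLin_eq_toLin]
  rw [multEig, ← h2, ← h1]
  have h3 : KK A lam = (Module.End.eigenspace A.toEuclideanLin lam).map (WithLp.linearEquiv 2 ℝ (α → ℝ)).toLinearMap := by
    ext x
    rw [Submodule.mem_map_equiv]
    simp [KK, sub_eq_zero]
    rw [← (WithLp.ofLp_injective 2).eq_iff]
    simp
  rw [h3, LinearEquiv.finrank_map_eq]

lemma root_of {α : Type*} [Fintype α] [DecidableEq α]
    (A : Matrix α α ℝ) (lam : ℝ) (x : α → ℝ) (hx : x ∈ KK A lam) (h0 : x ≠ 0) :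
    A.charpoly.IsRoot lam := by
  rw [← Matrix.charpoly_toLin', ← Module.End.hasEigenvalue_iff_isRoot_charpoly]
  apply Module.End.hasEigenvalue_of_hasEigenvector (x := x)
  refine ⟨?_, h0⟩
  rw [Module.End.mem_eigenspace_iff]
  ext i
  exact mem_KK.1 hx i

/-- restriction -/
lemma restrict_KK {α β : Type*} [Fintype α] [Fintype β] (A : Matrix α α ℝ) (lam : ℝ) (f : β → α)
    (hf : Function.Injective f) (x : α → ℝ) (hx : x ∈ KK A lam)
    (h : ∀ b u, u ∉ Set.range f → A (f b) u * x u = 0) :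
    (fun b => x (f b)) ∈ KK (A.submatrix f f) lam := by
  rw [mem_KK] at hx ⊢
  intro b
  rw [← hx (f b)]
  exact Fintype.sum_of_injective f hf _ _ (fun i hi => h b i hi) (fun i => rfl)

/-- branches -/
lemma branch {V : Type*} {G : SimpleGraph V} (hG : G.IsAcyclic) {c u w : V} (hu : G.Adj c u) (hw : G.Adj c w)
    (h : (G.induce {x | x ≠ c}).connectedComponentMk ⟨u, hu.ne'⟩ =
      (G.induce {x | x ≠ c}).connectedComponentMk ⟨w, hw.ne'⟩) : u = w := by
  classical
  by_contra hne
  rw [SimpleGraph.ConnectedComponent.eq] at h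
  obtain ⟨p⟩ := h
  let q : G.Walk u w := p.map (SimpleGraph.Embedding.induce {x | x ≠ c}).toHom
  have hq : c ∉ q.support := by
    intro hc
    have hc := (SimpleGraph.Walk.support_map _ p) ▸ hc
    rw [List.mem_map] at hc
    obtain ⟨z, -, hz⟩ := hc
    exact z.2 hz
  let r : G.Path u w := ⟨q.bypass, q.bypass_isPath⟩
  let s : G.Path u w := ⟨.cons hu.symm (.cons hw .nil), by
    simp [hne, hu.ne', hw.ne]⟩
  have := (hG.subsingleton_path u w).elim r s
  have hc : c ∈ (r : G.Walk u w).support := by rw [this]; simp [s]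
  exact hq (SimpleGraph.Walk.support_bypass_subset_support q hc)

lemma parter_abs {α : Type*} [Fintype α] (M : Matrix α α ℝ) (hM : M.IsSymm) (lam : ℝ) (c : α)
    [Fintype ↥{x : α | x ≠ c}] (Z : α → ℝ) (hc : Z c = 0)
    (hj : ∀ j, j ≠ c → ∑ i, M j i * Z i = lam * Z j) (hφ : ∑ i, M c i * Z i ≠ 0) :
    (∀ x ∈ KK M lam, x c = 0) ∧
    Module.finrank ℝ (KK (M.submatrix (fun x : ↥{x : α | x ≠ c} => (x : α))
        (fun x : ↥{x : α | x ≠ c} => (x : α))) lam) = Module.finrank ℝ (KK M lam) + 1 := by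
  classical
  have hvan : ∀ x ∈ KK M lam, x c = 0 := by
    intro x hx
    rw [mem_KK] at hx
    have e1 : ∑ i, Z i * ∑ j, M i j * x j = ∑ j, x j * ∑ i, M j i * Z i := by
      simp only [Finset.mul_sum]
      rw [Finset.sum_comm]
      refine Finset.sum_congr rfl fun j _ => Finset.sum_congr rfl fun i _ => ?_
      rw [hM.apply j i]
      ring
    have e2 : ∑ i, Z i * ∑ j, M i j * x j = ∑ j, x j * (lam * Z j) := by
      refine Finset.sum_congr rfl fun j _ => ?_
      rw [hx]; ring
    have e3 : ∑ j, (x j * ∑ i, M j i * Z i - x j * (lam * Z j)) = 0 := by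
      rw [Finset.sum_sub_distrib, ← e1, e2, sub_self]
    rw [Finset.sum_eq_single c] at e3
    · rw [hc] at e3
      have : x c * ∑ i, M c i * Z i = 0 := by linarith
      exact (mul_eq_zero.1 this).resolve_right hφ
    · intro j _ hjc
      rw [hj j hjc, sub_self]
    · simp
  refine ⟨hvan, ?_⟩
  set f : ↥{x : α | x ≠ c} → α := fun x => (x : α) with hf
  have hinj : Function.Injective f := Subtype.val_injective
  have hran : ∀ u, u ∉ Set.range f → u = c := by
    intro u hu
    by_contra h
    exact hu ⟨⟨u, h⟩, rfl⟩
  have hsum : ∀ (x : α → ℝ), x c = 0 → ∀ i, ∑ b, M i (f b) * x (f b) = ∑ j, M i j * x j := by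
    intro x hx i
    refine Fintype.sum_of_injective f hinj _ _ (fun u hu => ?_) (fun i => rfl)
    rw [hran u hu, hx, mul_zero]
  let φ : KK (M.submatrix f f) lam →ₗ[ℝ] ℝ :=
    (∑ b, M c (f b) • (LinearMap.proj b : (↥{x : α | x ≠ c} → ℝ) →ₗ[ℝ] ℝ)).comp (Submodule.subtype _)
  have hφa : ∀ z, φ z = ∑ b, M c (f b) * z.1 b := by
    intro z; simp [φ]
  let L : KK M lam →ₗ[ℝ] KK (M.submatrix f f) lam :=
    { toFun := fun x => ⟨fun b => x.1 (f b), restrict_KK M lam f hinj x.1 x.2 (by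
        intro b u hu
        rw [hran u hu, hvan _ x.2, mul_zero])⟩
      map_add' := fun x y => rfl
      map_smul' := fun x y => rfl }
  have hL : Function.Injective L := by
    intro x y hxy
    ext i
    by_cases hi : i = c
    · rw [hi, hvan _ x.2, hvan _ y.2]
    · exact congrFun (congrArg Subtype.val hxy) ⟨i, hi⟩
  have hLr : LinearMap.range L = LinearMap.ker φ := by
    ext z
    rw [LinearMap.mem_range, LinearMap.mem_ker, hφa]
    constructor
    · rintro ⟨x, rfl⟩
      have := hsum x.1 (hvan _ x.2) c
      have h2 := mem_KK.1 x.2 c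
      rw [hvan _ x.2, mul_zero] at h2
      rw [← h2, ← this]
      rfl
    · intro hz
      let x : α → ℝ := fun i => if h : i ≠ c then z.1 ⟨i, h⟩ else 0
      have hxc : x c = 0 := by simp [x]
      have hxf : ∀ b, x (f b) = z.1 b := by
        intro b
        have : f b ≠ c := b.2
        simp only [x, dif_pos this]
        rfl
      refine ⟨⟨x, mem_KK.2 ?_⟩, ?_⟩
      · intro i
        rw [← hsum x hxc]
        simp only [hxf]
        by_cases hi : i = c
        · rw [hi, hz, hxc, mul_zero]
        · have := mem_KK.1 z.2 ⟨i, hi⟩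
          rw [show x i = z.1 ⟨i, hi⟩ from hxf ⟨i, hi⟩]
          exact this
      · ext b
        exact hxf b
  have hZ : (fun b => Z (f b)) ∈ KK (M.submatrix f f) lam := by
    rw [mem_KK]
    intro b
    exact (hsum Z hc (f b)).trans (hj _ b.2)
  have hsurj : LinearMap.range φ = ⊤ := by
    rw [LinearMap.range_eq_top]
    apply LinearMap.surjective
    intro h
    apply hφ
    have := hφa ⟨_, hZ⟩
    rw [h] at this
    rw [← hsum Z hc c]
    exact this.symm
  have h1 := LinearMap.finrank_range_add_finrank_ker φ
  rw [hsurj, ← hLr, LinearMap.finrank_range_of_inj hL] at h1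
  simp only [finrank_top, Module.finrank_self] at h1
  omega

lemma parter_exists {α : Type*} [Fintype α] {G : SimpleGraph α} (hG : G.IsAcyclic)
    (M : Matrix α α ℝ) (hMG : MatchesGraph M G) (lam : ℝ) (c a : α) (hca : G.Adj c a)
    (y : α → ℝ) (hy : y ∈ KK M lam) (hyc : y c = 0) (hya : y a ≠ 0) :
    ∃ Z : α → ℝ, Z c = 0 ∧
    (∀ j, j ≠ c → ∑ i, M j i * Z i = lam * Z j) ∧ ∑ i, M c i * Z i ≠ 0 := by
  classical
  rw [mem_KK] at hy
  let H := G.induce {x | x ≠ c}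
  let p : α → Prop := fun i => ∃ h : i ≠ c, H.connectedComponentMk ⟨i, h⟩ =
    H.connectedComponentMk ⟨a, hca.ne'⟩
  have key : ∀ i j, p i → j ≠ c → ¬ p j → M j i = 0 ∧ M i j = 0 := by
    rintro i j ⟨hi, hpi⟩ hj hpj
    have hij : i ≠ j := by rintro rfl; exact hpj ⟨hi, hpi⟩
    have hadj : ¬ G.Adj i j := by
      intro h
      apply hpj
      refine ⟨hj, hpi ▸ ?_⟩
      apply SimpleGraph.ConnectedComponent.connectedComponentMk_eq_of_adj
      exact h.symm
    constructor
    · by_contra h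
      exact hadj ((hMG j i hij.symm).1 h).symm
    · by_contra h
      exact hadj ((hMG i j hij).1 h)
  have hpa : p a := ⟨hca.ne', rfl⟩
  obtain ⟨Z, hZ⟩ : ∃ Z : α → ℝ, ∀ i, Z i = if p i then y i else 0 := ⟨_, fun _ => rfl⟩
  refine ⟨Z, ?_, ?_, ?_⟩
  · simp [hZ, hyc]
  · intro j hj
    simp only [hZ]
    by_cases hpj : p j
    · rw [if_pos hpj, ← hy j]
      refine Finset.sum_congr rfl fun i _ => ?_
      by_cases hpi : p i
      · rw [if_pos hpi]
      · rw [if_neg hpi, mul_zero]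
        by_cases hic : i = c
        · rw [hic, hyc, mul_zero]
        · rw [(key j i hpj hic hpi).2, zero_mul]
    · rw [if_neg hpj, mul_zero]
      refine Finset.sum_eq_zero fun i _ => ?_
      by_cases hpi : p i
      · rw [(key i j hpi hj hpj).1, zero_mul]
      · rw [if_neg hpi, mul_zero]
  · simp only [hZ]
    rw [Finset.sum_eq_single a]
    · rw [if_pos hpa]
      exact mul_ne_zero ((hMG c a hca.ne).2 hca) hya
    · intro i _ hia
      by_cases hpi : p i
      · obtain ⟨hi, hpi'⟩ := hpi
        have : M c i = 0 := by
          by_contra h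
          have hci := (hMG c i hi.symm).1 h
          exact hia (branch hG hci hca hpi')
        rw [this, zero_mul]
      · rw [if_neg hpi, mul_zero]
    · simp

/-- the component of a neighbour `f` in `G - c` carries the eigenvalue -/
lemma comp_root {α : Type*} [Fintype α] {G : SimpleGraph α}
    (M : Matrix α α ℝ) (hMG : MatchesGraph M G) (lam : ℝ) (c f : α) (hf : f ≠ c)
    (C : (G.induce {x | x ≠ c}).ConnectedComponent)
    (hC : (G.induce {x | x ≠ c}).connectedComponentMk ⟨f, hf⟩ = C)
    [Fintype {w : ↥{x : α | x ≠ c} // (G.induce {x : α | x ≠ c}).connectedComponentMk w = C}]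
    [DecidableEq {w : ↥{x : α | x ≠ c} // (G.induce {x : α | x ≠ c}).connectedComponentMk w = C}]
    (y : α → ℝ) (hy : y ∈ KK M lam) (hyc : y c = 0) (hyf : y f ≠ 0) :
    ((M.submatrix
            (fun w : {w : ↥{x : α | x ≠ c} //
                (G.induce {x : α | x ≠ c}).connectedComponentMk w = C} =>
              ((w : ↥{x : α | x ≠ c}) : α))
            (fun w : {w : ↥{x : α | x ≠ c} //
                (G.induce {x : α | x ≠ c}).connectedComponentMk w = C} =>
              ((w : ↥{x : α | x ≠ c}) : α))).charpoly).IsRoot lam := by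
  refine root_of _ lam _ (restrict_KK M lam _ ?_ y hy ?_) ?_
  · intro u v h
    exact Subtype.ext (Subtype.ext h)
  · rintro ⟨⟨b, hb⟩, hbC⟩ u hu
    by_cases huc : u = c
    · rw [huc, hyc, mul_zero]
    · have : M b u = 0 := by
        by_contra h
        have hbu : b ≠ u := by
          rintro rfl
          exact hu ⟨⟨⟨b, hb⟩, hbC⟩, rfl⟩
        have hadj := (hMG b u hbu).1 h
        refine hu ⟨⟨⟨u, huc⟩, ?_⟩, rfl⟩
        rw [← hbC]
        apply SimpleGraph.ConnectedComponent.connectedComponentMk_eq_of_adj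
        exact hadj.symm
      show M b u * _ = 0
      rw [this, zero_mul]
  · intro h
    exact hyf (congrFun h ⟨⟨f, hf⟩, hC⟩)

lemma propagate {α : Type*} [Fintype α] {G : SimpleGraph α} (hG : G.IsAcyclic)
    (M : Matrix α α ℝ) (hM : M.IsSymm) (hMG : MatchesGraph M G) (lam : ℝ)
    (hno : ∀ c a d u, G.Adj c a → ∀ hcd : G.Adj c d, G.Adj c u → a ≠ d → a ≠ u → d ≠ u →
      (∀ x ∈ KK M lam, x c = 0) → (∃ x ∈ KK M lam, x a ≠ 0) →
      (∃ b, ∃ hb : b ≠ c, (G.induce {x | x ≠ c}).connectedComponentMk ⟨d, hcd.ne'⟩ =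
        (G.induce {x | x ≠ c}).connectedComponentMk ⟨b, hb⟩ ∧ ∃ x ∈ KK M lam, x b ≠ 0) →
      (∃ x ∈ KK M lam, x u ≠ 0) → False)
    (y : α → ℝ) (hy : y ∈ KK M lam) (N : ℕ) : ∀ (a b : α) (p : G.Walk a b), p.IsPath → p.length ≤ N →
    (∃ x ∈ KK M lam, x a ≠ 0) → y a = 0 → (∃ x ∈ KK M lam, x b ≠ 0) → y b = 0 := by
  classical
  induction N with
  | zero =>
    intro a b p hp hl ha hya hb
    have := SimpleGraph.Walk.eq_of_length_eq_zero (Nat.le_zero.1 hl)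
    exact this ▸ hya
  | succ N ih =>
    intro a b p hp hl ha hya hb
    cases p with
    | nil => exact hya
    | @cons _ c _ hac q =>
      rw [SimpleGraph.Walk.cons_isPath_iff] at hp
      rw [SimpleGraph.Walk.length_cons] at hl
      by_cases hc : ∃ x ∈ KK M lam, x c ≠ 0
      · refine ih c b q hp.1 (by omega) hc ?_ hb
        by_contra hyc
        obtain ⟨Z, h1, h2, h3⟩ := parter_exists hG M hMG lam a c hac y hy hya hyc
        obtain ⟨x, hx, hxa⟩ := ha
        exact hxa ((parter_abs M hM lam a Z h1 h2 h3).1 x hx)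
      · have hc0 : ∀ x ∈ KK M lam, x c = 0 := by
          intro x hx
          by_contra h
          exact hc ⟨x, hx, h⟩
        cases q with
        | nil => exact absurd hb hc
        | @cons _ d _ hcd r =>
          have hp2 := hp.2
          rw [SimpleGraph.Walk.cons_isPath_iff] at hp
          rw [SimpleGraph.Walk.length_cons] at hl
          have had : a ≠ d := by
            rintro rfl
            apply hp2
            simp
          have hMcd : M c d ≠ 0 := (hMG c d hcd.ne).2 hcd
          have hMca : M c a ≠ 0 := (hMG c a hac.ne').2 hac.symm
          obtain ⟨x, hx, hxa⟩ := id ha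
          have hother : (∃ b, ∃ hb : b ≠ c, (G.induce {x | x ≠ c}).connectedComponentMk ⟨d, hcd.ne'⟩ =
              (G.induce {x | x ≠ c}).connectedComponentMk ⟨b, hb⟩ ∧ ∃ x ∈ KK M lam, x b ≠ 0) := by
            refine ⟨b, fun h => hp.1.2 (h ▸ r.end_mem_support), ?_, hb⟩
            rw [SimpleGraph.ConnectedComponent.eq]
            refine ⟨r.induce {x | x ≠ c} ?_⟩
            intro z hz h
            exact hp.1.2 (h ▸ hz)
          have hsum : ∀ z ∈ KK M lam, M c a * z a + M c d * z d = 0 := by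
            intro z hz
            have := mem_KK.1 hz c
            rw [hc0 z hz, mul_zero, ← Finset.sum_subset (Finset.subset_univ {a, d})] at this
            · rwa [Finset.sum_pair had] at this
            · intro u _ hu
              simp only [Finset.mem_insert, Finset.mem_singleton, not_or] at hu
              by_contra hne
              have hzu : z u ≠ 0 := right_ne_zero_of_mul hne
              have hcu : c ≠ u := by
                rintro rfl
                exact hzu (hc0 z hz)
              have hadj := (hMG c u hcu).1 (left_ne_zero_of_mul hne)
              exact hno c a d u hac.symm hcd hadj had (Ne.symm hu.1) (Ne.symm hu.2) hc0 ha hother ⟨z, hz, hzu⟩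
          have h2 := hsum y hy
          rw [hya, mul_zero, zero_add] at h2
          have hd : ∃ x ∈ KK M lam, x d ≠ 0 := by
            refine ⟨x, hx, fun h => ?_⟩
            have h3 := hsum x hx
            rw [h, mul_zero, add_zero] at h3
            exact (mul_ne_zero hMca hxa) h3
          exact ih d b r hp.1.1 (by omega) hd ((mul_eq_zero.1 h2).resolve_left hMcd) hb

open scoped Classical in
/-- **Parter–Wiener theorem.** If `lam` has multiplicity at least 2 in a symmetric
matrix `M` whose underlying graph is a tree `T`, then there is a vertex `v` of degree
at least 3 such that deleting `v` raises the multiplicity by one, and `lam` is an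
eigenvalue of the principal submatrices corresponding to at least three connected
components of `T - v`. -/
theorem stmt2 {n : ℕ} (G : SimpleGraph (Fin n)) (hT : G.IsTree)
    (M : Matrix (Fin n) (Fin n) ℝ) (hM : M.IsSymm) (hMG : MatchesGraph M G)
    (lam : ℝ) (hmult : 2 ≤ multEig M lam) :
    ∃ v : Fin n, 3 ≤ (G.neighborSet v).ncard ∧
      multEig (M.submatrix (fun x : ↥{x : Fin n | x ≠ v} => (x : Fin n))
        (fun x : ↥{x : Fin n | x ≠ v} => (x : Fin n))) lam = multEig M lam + 1 ∧
      ∃ S : Finset ((G.induce {x : Fin n | x ≠ v}).ConnectedComponent),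
        3 ≤ S.card ∧ ∀ c ∈ S,
          ((M.submatrix
            (fun w : {w : ↥{x : Fin n | x ≠ v} //
                (G.induce {x : Fin n | x ≠ v}).connectedComponentMk w = c} =>
              ((w : ↥{x : Fin n | x ≠ v}) : Fin n))
            (fun w : {w : ↥{x : Fin n | x ≠ v} //
                (G.induce {x : Fin n | x ≠ v}).connectedComponentMk w = c} =>
              ((w : ↥{x : Fin n | x ≠ v}) : Fin n))).charpoly).IsRoot lam := by
  rw [multEig_eq M hM] at hmult ⊢
  by_contra hcon
  have hKbot : ∃ x ∈ KK M lam, x ≠ 0 := by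
    apply Submodule.exists_mem_ne_zero_of_ne_bot
    intro h
    rw [h, finrank_bot] at hmult
    omega
  obtain ⟨x0, hx0, hx0ne⟩ := hKbot
  obtain ⟨f0, hf0⟩ := Function.ne_iff.1 hx0ne
  let ev : KK M lam →ₗ[ℝ] ℝ := (LinearMap.proj f0).comp (Submodule.subtype _)
  have hev : ∃ y ∈ LinearMap.ker ev, y ≠ 0 := by
    apply Submodule.exists_mem_ne_zero_of_ne_bot
    intro h
    have h1 := LinearMap.finrank_range_add_finrank_ker ev
    rw [h, finrank_bot] at h1
    have h2 := Submodule.finrank_le (LinearMap.range ev)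
    rw [Module.finrank_self] at h2
    omega
  obtain ⟨⟨y, hy⟩, hyev, hyne⟩ := hev
  have hyf0 : y f0 = 0 := hyev
  apply hyne
  ext b
  show y b = 0
  by_contra hyb
  obtain ⟨p, hp⟩ := (hT.connected.preconnected f0 b).exists_isPath
  refine hyb (propagate hT.isAcyclic M hM hMG lam ?_ y hy p.length f0 b p hp le_rfl
    ⟨x0, hx0, hf0⟩ hyf0 ⟨y, hy, hyb⟩)
  rintro c a d u hca hcd hcu had hau hdu hc0 ⟨xa, hxa, hxa0⟩ ⟨b', hb', hbd, xb, hxb, hxb0⟩ ⟨xu, hxu, hxu0⟩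
  apply hcon
  obtain ⟨Z, h1, h2, h3⟩ := parter_exists hT.isAcyclic M hMG lam c a hca xa hxa (hc0 _ hxa) hxa0
  refine ⟨c, ?_, ?_, ?_⟩
  · have : ({a, d, u} : Set (Fin n)).ncard = 3 := Set.ncard_eq_three.2 ⟨a, d, u, had, hau, hdu, rfl⟩
    rw [← this]
    apply Set.ncard_le_ncard _ (Set.toFinite _)
    rintro z (rfl | rfl | rfl) <;> assumption
  · rw [multEig_eq _ (hM.submatrix _)]
    exact (parter_abs M hM lam c Z h1 h2 h3).2
  · refine ⟨{(G.induce {x | x ≠ c}).connectedComponentMk ⟨a, hca.ne'⟩,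
      (G.induce {x | x ≠ c}).connectedComponentMk ⟨d, hcd.ne'⟩,
      (G.induce {x | x ≠ c}).connectedComponentMk ⟨u, hcu.ne'⟩}, ?_, ?_⟩
    · rw [Finset.card_eq_three.2 ⟨_, _, _, ?_, ?_, ?_, rfl⟩]
      · exact fun h => had (branch hT.isAcyclic hca hcd h)
      · exact fun h => hau (branch hT.isAcyclic hca hcu h)
      · exact fun h => hdu (branch hT.isAcyclic hcd hcu h)
    · intro C hC
      simp only [Finset.mem_insert, Finset.mem_singleton] at hC
      rcases hC with hC | hC | hC
      · exact comp_root M hMG lam c a hca.ne' C hC.symm xa hxa (hc0 _ hxa) hxa0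
      · exact comp_root M hMG lam c b' hb' C (hbd.symm.trans hC.symm) xb hxb (hc0 _ hxb) hxb0
      · exact comp_root M hMG lam c u hcu.ne' C hC.symm xu hxu (hc0 _ hxu) hxu0
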